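/- (Criterion: AA𝒞 implies A𝒞.) Let A be a separable C*-algebra which is the inductive limit of an inductive system (A_k, γ_k) of separable C*-algebras, where each A_k is itself the inductive limit of an inductive system (A_k^n, ρ_k^n)_{n∈ℕ} in which every algebra A_k^n is a separable weakly semiprojective C*-algebra. Then there exist indices (k_1,n_1), (k_2,n_2), … and *-homomorphisms ψ_j : A_{k_j}^{n_j} → A_{k_{j+1}}^{n_{j+1}} such that A is isomorphic to the inductive limit of the system (A_{k_j}^{n_j}, ψ_j). In particular, an inductive limit of inductive limits of weakly semiprojective C*-algebras is itself an inductive limit of (some of) those weakly semiprojective C*-algebras. -/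

import Mathlib

open Filter Topology Set

noncomputable section

universe u v

/-- The iterated connecting morphisms `γ_{k+n,k} : A_k → A_{k+n}` of an inductive system. -/
def iterHom {A : ℕ → Type u} [∀ k, NonUnitalCStarAlgebra (A k)]
    (γ : ∀ k, A k →⋆ₙₐ[ℂ] A (k + 1)) : ∀ k n : ℕ, A k →⋆ₙₐ[ℂ] A (k + n)
  | _, 0 => NonUnitalStarAlgHom.id ℂ _
  | k, n + 1 => (γ (k + n)).comp (iterHom γ k n)

/-- `(L, μ)` is the inductive limit of the inductive system `(A, γ)` of C*-algebras. -/
structure IsInductiveLimit {A : ℕ → Type u} [∀ k, NonUnitalCStarAlgebra (A k)]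
    (γ : ∀ k, A k →⋆ₙₐ[ℂ] A (k + 1)) (L : Type v) [NonUnitalCStarAlgebra L]
    (μ : ∀ k, A k →⋆ₙₐ[ℂ] L) : Prop where
  compat : ∀ k, (μ (k + 1)).comp (γ k) = μ k
  dense_union : Dense (⋃ k, Set.range (μ k))
  norm_tendsto : ∀ (k : ℕ) (a : A k),
    Tendsto (fun n => ‖iterHom γ k n a‖) atTop (𝓝 ‖μ k a‖)

/-- Two *-homomorphisms are homotopic if they are connected by a path of *-homomorphisms,
i.e. by a *-homomorphism into `C([0,1], B)`. -/
def Homotopic {A : Type u} {B : Type v} [NonUnitalCStarAlgebra A] [NonUnitalCStarAlgebra B]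
    (φ ψ : A →⋆ₙₐ[ℂ] B) : Prop :=
  ∃ H : A →⋆ₙₐ[ℂ] C(unitInterval, B), (∀ a, H a 0 = φ a) ∧ (∀ a, H a 1 = ψ a)

/-- A *-homomorphism is null-homotopic if it is homotopic to the zero morphism. -/
def NullHomotopic {A : Type u} {B : Type v} [NonUnitalCStarAlgebra A] [NonUnitalCStarAlgebra B]
    (φ : A →⋆ₙₐ[ℂ] B) : Prop :=
  Homotopic φ 0

/-- A C*-algebra is contractible if its identity is null-homotopic. -/
def Contractible (A : Type u) [NonUnitalCStarAlgebra A] : Prop :=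
  NullHomotopic (NonUnitalStarAlgHom.id ℂ A)

/-- A projective *-homomorphism between C*-algebras. -/
def IsProjectiveMorphism {A B : Type u} [NonUnitalCStarAlgebra A] [NonUnitalCStarAlgebra B]
    (φ : A →⋆ₙₐ[ℂ] B) : Prop :=
  ∀ (C D : Type u) [NonUnitalCStarAlgebra C] [NonUnitalCStarAlgebra D]
    (π : C →⋆ₙₐ[ℂ] D), Function.Surjective π → ∀ σ : B →⋆ₙₐ[ℂ] D,
    ∃ ψ : A →⋆ₙₐ[ℂ] C, π.comp ψ = σ.comp φ

/-- A projective C*-algebra. -/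
def IsProjective (A : Type u) [NonUnitalCStarAlgebra A] : Prop :=
  IsProjectiveMorphism (NonUnitalStarAlgHom.id ℂ A)

/-- A semiprojective *-homomorphism between C*-algebras. -/
def IsSemiprojectiveMorphism {A B : Type u} [NonUnitalCStarAlgebra A] [NonUnitalCStarAlgebra B]
    (φ : A →⋆ₙₐ[ℂ] B) : Prop :=
  ∀ (C : ℕ → Type u) [∀ k, NonUnitalCStarAlgebra (C k)]
    (δ : ∀ k, C k →⋆ₙₐ[ℂ] C (k + 1)), (∀ k, Function.Surjective (δ k)) →
    ∀ (L : Type u) [NonUnitalCStarAlgebra L] (μ : ∀ k, C k →⋆ₙₐ[ℂ] L),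
    IsInductiveLimit δ L μ → ∀ σ : B →⋆ₙₐ[ℂ] L,
    ∃ (k : ℕ) (ψ : A →⋆ₙₐ[ℂ] C k), (μ k).comp ψ = σ.comp φ

/-- A semiprojective C*-algebra. -/
def IsSemiprojective (A : Type u) [NonUnitalCStarAlgebra A] : Prop :=
  IsSemiprojectiveMorphism (NonUnitalStarAlgHom.id ℂ A)

/-- A weakly semiprojective *-homomorphism between C*-algebras. -/
def IsWeaklySemiprojectiveMorphism {A B : Type u} [NonUnitalCStarAlgebra A]
    [NonUnitalCStarAlgebra B] (φ : A →⋆ₙₐ[ℂ] B) : Prop :=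
  ∀ (C : ℕ → Type u) [∀ k, NonUnitalCStarAlgebra (C k)]
    (δ : ∀ k, C k →⋆ₙₐ[ℂ] C (k + 1)), (∀ k, Function.Surjective (δ k)) →
    ∀ (L : Type u) [NonUnitalCStarAlgebra L] (μ : ∀ k, C k →⋆ₙₐ[ℂ] L),
    IsInductiveLimit δ L μ → ∀ σ : B →⋆ₙₐ[ℂ] L,
    ∀ ε : ℝ, 0 < ε → ∀ F : Finset A,
    ∃ (k : ℕ) (ψ : A →⋆ₙₐ[ℂ] C k), ∀ x ∈ F, ‖μ k (ψ x) - σ (φ x)‖ < ε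

/-- A weakly semiprojective C*-algebra. -/
def IsWeaklySemiprojective (A : Type u) [NonUnitalCStarAlgebra A] : Prop :=
  IsWeaklySemiprojectiveMorphism (NonUnitalStarAlgHom.id ℂ A)

/-- A weakly projective C*-algebra. -/
def IsWeaklyProjective (A : Type u) [NonUnitalCStarAlgebra A] : Prop :=
  ∀ (C D : Type u) [NonUnitalCStarAlgebra C] [NonUnitalCStarAlgebra D]
    (π : C →⋆ₙₐ[ℂ] D), Function.Surjective π → ∀ σ : A →⋆ₙₐ[ℂ] D,
    ∀ ε : ℝ, 0 < ε → ∀ F : Finset A,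
    ∃ ψ : A →⋆ₙₐ[ℂ] C, ∀ x ∈ F, ‖π (ψ x) - σ x‖ < ε

/-- `F ⊂_ε G` : every element of `F` is within `ε` of some element of `G`. -/
def EpsContained {A : Type*} [NonUnitalCStarAlgebra A] (ε : ℝ) (F G : Set A) : Prop :=
  ∀ x ∈ F, ∃ y ∈ G, ‖x - y‖ < ε

/-- A subset of a C*-algebra which is a sub-C*-algebra. -/
def IsCStarSubset {A : Type*} [NonUnitalCStarAlgebra A] (S : Set A) : Prop :=
  IsClosed S ∧ (0 : A) ∈ S ∧ (∀ x ∈ S, ∀ y ∈ S, x + y ∈ S) ∧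
    (∀ x ∈ S, ∀ y ∈ S, x * y ∈ S) ∧ (∀ (c : ℂ), ∀ x ∈ S, c • x ∈ S) ∧ ∀ x ∈ S, star x ∈ S

/-- A C*-algebra is finitely generated if some finite subset is contained in no proper
sub-C*-algebra. -/
def IsFinitelyGeneratedCStar (A : Type*) [NonUnitalCStarAlgebra A] : Prop :=
  ∃ S : Finset A, ∀ T : Set A, IsCStarSubset T → ↑S ⊆ T → T = Set.univ

end
noncomputable section
universe w

/-- A bundled inductive system of C*-algebras. -/
structure CStarInductiveSystem : Type (w + 1) where
  X : ℕ → Type w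
  inst : ∀ k, NonUnitalCStarAlgebra (X k)
  conn : ∀ k, X k →⋆ₙₐ[ℂ] X (k + 1)

attribute [instance] CStarInductiveSystem.inst

/-- `A` is (isomorphic to) an inductive limit of projective C*-algebras,
i.e. `A` has trivial shape. -/
def IsInductiveLimitOfProjectives (A : Type w) [NonUnitalCStarAlgebra A] : Prop :=
  ∃ (S : CStarInductiveSystem.{w}) (μ : ∀ k, S.X k →⋆ₙₐ[ℂ] A),
    IsInductiveLimit S.conn A μ ∧ ∀ k, IsProjective (S.X k)

end

section Limits

lemma NonUnitalStarAlgHom.dist_map_le {B : Type u} {D : Type v} [NonUnitalCStarAlgebra B]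
    [NonUnitalCStarAlgebra D] (f : B →⋆ₙₐ[ℂ] D) (x y : B) : dist (f x) (f y) ≤ dist x y := by
  rw [dist_eq_norm, dist_eq_norm, ← map_sub]
  exact NonUnitalStarAlgHom.norm_apply_le f _

/-- A sequence of *-homomorphisms which is pointwise Cauchy on a dense set converges pointwise
to a *-homomorphism. -/
lemma exists_pointwise_limit {B : Type u} {D : Type v} [NonUnitalCStarAlgebra B]
    [NonUnitalCStarAlgebra D] (f : ℕ → B →⋆ₙₐ[ℂ] D) {s : Set B} (hs : Dense s)
    (hf : ∀ x ∈ s, CauchySeq fun n => f n x) :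
    ∃ g : B →⋆ₙₐ[ℂ] D, ∀ x, Tendsto (fun n => f n x) atTop (𝓝 (g x)) := by
  have hc : ∀ x, CauchySeq fun n => f n x := by
    intro x
    rw [Metric.cauchySeq_iff]
    intro ε hε
    obtain ⟨y, hy, hxy⟩ := hs.exists_dist_lt x (ε := ε / 3) (by positivity)
    obtain ⟨N, hN⟩ := Metric.cauchySeq_iff.1 (hf y hy) (ε / 3) (by positivity)
    refine ⟨N, fun m hm n hn => ?_⟩
    have h1 := (f m).dist_map_le x y
    have h2 := (f n).dist_map_le y x
    rw [dist_comm y x] at h2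
    have h3 := hN m hm n hn
    have h4 := dist_triangle4 (f m x) (f m y) (f n y) (f n x)
    linarith
  choose g hg using fun x => cauchySeq_tendsto_of_complete (hc x)
  refine ⟨{ toFun := g, map_smul' := fun c x => ?_, map_zero' := ?_, map_add' := fun x y => ?_,
            map_mul' := fun x y => ?_, map_star' := fun x => ?_ }, hg⟩
  · refine tendsto_nhds_unique (hg _) ?_
    simpa using (hg x).const_smul c
  · refine tendsto_nhds_unique (hg _) ?_
    simp
  · refine tendsto_nhds_unique (hg _) ?_
    simpa using (hg x).add (hg y)
  · refine tendsto_nhds_unique (hg _) ?_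
    simpa using (hg x).mul (hg y)
  · refine tendsto_nhds_unique (hg _) ?_
    simpa only [← map_star] using (hg x).star

/-- Convergence of norms along a sequence of *-homomorphisms may be checked on a dense set. -/
lemma tendsto_norm_of_dense {B : Type u} {D : Type v} {E : ℕ → Type*} [NonUnitalCStarAlgebra B]
    [NonUnitalCStarAlgebra D] [∀ n, NonUnitalCStarAlgebra (E n)] (h : ∀ n, B →⋆ₙₐ[ℂ] E n)
    (g : B →⋆ₙₐ[ℂ] D) {s : Set B} (hs : Dense s)
    (hh : ∀ x ∈ s, Tendsto (fun n => ‖h n x‖) atTop (𝓝 ‖g x‖)) (x : B) :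
    Tendsto (fun n => ‖h n x‖) atTop (𝓝 ‖g x‖) := by
  rw [Metric.tendsto_atTop]
  intro ε hε
  obtain ⟨y, hy, hxy⟩ := hs.exists_dist_lt x (ε := ε / 3) (by positivity)
  obtain ⟨N, hN⟩ := Metric.tendsto_atTop.1 (hh y hy) (ε / 3) (by positivity)
  refine ⟨N, fun n hn => ?_⟩
  have h1 : dist ‖h n x‖ ‖h n y‖ ≤ dist x y := (dist_norm_norm_le _ _).trans <| by
    simpa [dist_eq_norm] using (h n).dist_map_le x y
  have h2 : dist ‖g y‖ ‖g x‖ ≤ dist x y := (dist_norm_norm_le _ _).trans <| by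
    simpa [dist_eq_norm, norm_sub_rev] using g.dist_map_le y x
  have h3 := hN n hn
  have h4 := dist_triangle4 ‖h n x‖ ‖h n y‖ ‖g y‖ ‖g x‖
  linarith

end Limits

section Transition

variable {D : ℕ → Type u} [∀ k, NonUnitalCStarAlgebra (D k)]

/-- The morphism `D j → D m` of an inductive system, for arbitrary indices; it is zero if
`m < j`. -/
def transition (γ : ∀ k, D k →⋆ₙₐ[ℂ] D (k + 1)) (j : ℕ) : ∀ m, D j →⋆ₙₐ[ℂ] D m
  | 0 => if h : j = 0 then h ▸ NonUnitalStarAlgHom.id ℂ (D j) else 0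
  | m + 1 => if h : j = m + 1 then h ▸ NonUnitalStarAlgHom.id ℂ (D j) else
      (γ m).comp (transition γ j m)

variable (γ : ∀ k, D k →⋆ₙₐ[ℂ] D (k + 1))

lemma transition_self (j : ℕ) (x : D j) : transition γ j j x = x := by
  cases j <;> simp [transition]

lemma transition_succ {j m : ℕ} (h : j ≤ m) (x : D j) :
    transition γ j (m + 1) x = γ m (transition γ j m x) := by
  have : j ≠ m + 1 := by omega
  simp [transition, this]

lemma transition_of_lt {j m : ℕ} (h : m < j) (x : D j) : transition γ j m x = 0 := by
  induction m with
  | zero =>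
    have : j ≠ 0 := by omega
    simp [transition, this]
  | succ m ih =>
    have : j ≠ m + 1 := by omega
    simp [transition, this, ih (by omega)]

lemma transition_transition {i j m : ℕ} (hij : i ≤ j) (hjm : j ≤ m) (x : D i) :
    transition γ j m (transition γ i j x) = transition γ i m x := by
  induction m, hjm using Nat.le_induction with
  | base => exact transition_self γ j _
  | succ m hm ih => rw [transition_succ γ hm, ih, transition_succ γ (hij.trans hm)]

lemma transition_succ_left {j m : ℕ} (h : j + 1 ≤ m) (x : D j) :
    transition γ (j + 1) m (γ j x) = transition γ j m x := by
  rw [← transition_transition γ j.le_succ h, transition_succ γ le_rfl, transition_self]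

lemma iterHom_eq_transition (j n : ℕ) (x : D j) :
    iterHom γ j n x = transition γ j (j + n) x := by
  induction n with
  | zero => exact (transition_self γ j x).symm
  | succ n ih =>
    change γ (j + n) (iterHom γ j n x) = transition γ j (j + n + 1) x
    rw [transition_succ γ (by omega), ih]

variable {γ} {L : Type v} [NonUnitalCStarAlgebra L] {μ : ∀ k, D k →⋆ₙₐ[ℂ] L}

lemma map_transition (hμ : ∀ k, (μ (k + 1)).comp (γ k) = μ k) {j m : ℕ} (h : j ≤ m) (x : D j) :
    μ m (transition γ j m x) = μ j x := by
  induction m, h using Nat.le_induction with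
  | base => rw [transition_self]
  | succ m hm ih => rw [transition_succ γ hm, ← ih, ← hμ m]; rfl

lemma tendsto_iterHom_iff (j : ℕ) (x : D j) (c : ℝ) :
    Tendsto (fun n => ‖iterHom γ j n x‖) atTop (𝓝 c) ↔
      Tendsto (fun m => ‖transition γ j m x‖) atTop (𝓝 c) := by
  rw [← tendsto_add_atTop_iff_nat (f := fun m => ‖transition γ j m x‖) j]
  have h : (fun n => ‖iterHom γ j n x‖) = fun n => ‖transition γ j (n + j) x‖ := funext fun n => by
    rw [iterHom_eq_transition]
    exact congrArg (fun m => ‖transition γ j m x‖) (add_comm j n)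
  rw [h]

lemma IsInductiveLimit.eventually_exists_norm_sub_lt (hL : IsInductiveLimit γ L μ)
    {ε : ℝ} (hε : 0 < ε) (a : L) : ∀ᶠ m in atTop, ∃ b : D m, ‖μ m b - a‖ < ε := by
  obtain ⟨y, hy, hya⟩ := hL.dense_union.exists_dist_lt a hε
  obtain ⟨j, b, rfl⟩ := Set.mem_iUnion.1 hy
  filter_upwards [eventually_ge_atTop j] with m hm
  refine ⟨transition γ j m b, ?_⟩
  rw [map_transition hL.compat hm, ← dist_eq_norm, dist_comm]
  exact hya

end Transition

section Telescope

open scoped ENNReal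

variable {D : ℕ → Type u} [∀ k, NonUnitalCStarAlgebra (D k)]

/-- Evaluation of bounded sequences at an index. -/
noncomputable def lpEval (n : ℕ) : lp D ∞ →⋆ₙₐ[ℂ] D n where
  toFun d := d n
  map_smul' _ _ := rfl
  map_zero' := rfl
  map_add' _ _ := rfl
  map_mul' _ _ := rfl
  map_star' _ := rfl

@[simp] lemma lpEval_apply (n : ℕ) (d : lp D ∞) : lpEval n d = d n := rfl

/-- Replacing the entries of a bounded sequence below an index by zero. -/
noncomputable def lpTail (k : ℕ) : lp D ∞ →⋆ₙₐ[ℂ] lp D ∞ where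
  toFun d := ⟨fun n => if n < k then 0 else d n, memℓp_infty ⟨‖d‖, by
    rintro _ ⟨n, rfl⟩
    dsimp only
    split_ifs
    · simp
    · exact lp.norm_apply_le_norm ENNReal.top_ne_zero d n⟩⟩
  map_smul' c d := by ext n; by_cases h : n < k <;> simp [h]
  map_zero' := by ext n; by_cases h : n < k <;> simp [h]
  map_add' d e := by
    ext n
    change (if n < k then 0 else d n + e n) = (if n < k then 0 else d n) + if n < k then 0 else e n
    split_ifs <;> simp
  map_mul' d e := by ext n; by_cases h : n < k <;> simp [h, lp.infty_coeFn_mul]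
  map_star' d := by ext n; by_cases h : n < k <;> simp [h]

@[simp] lemma lpTail_apply (k : ℕ) (d : lp D ∞) (n : ℕ) :
    lpTail k d n = if n < k then 0 else d n := rfl

variable (γ : ∀ k, D k →⋆ₙₐ[ℂ] D (k + 1))

/-- The bounded sequences which vanish below `k` and eventually follow the connecting
morphisms. -/
def coherentSubalgebra (k : ℕ) : NonUnitalStarSubalgebra ℂ (lp D ∞) where
  carrier := {d | (∀ᶠ n in atTop, γ n (d n) = d (n + 1)) ∧ ∀ n < k, d n = 0}
  add_mem' := by
    rintro d e ⟨hd, hd'⟩ ⟨he, he'⟩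
    refine ⟨?_, fun n hn => by simp [hd' n hn, he' n hn]⟩
    filter_upwards [hd, he] with n h1 h2
    simp [h1, h2]
  zero_mem' := by simp
  mul_mem' := by
    rintro d e ⟨hd, hd'⟩ ⟨he, he'⟩
    refine ⟨?_, fun n hn => by simp [lp.infty_coeFn_mul, hd' n hn]⟩
    filter_upwards [hd, he] with n h1 h2
    simp [lp.infty_coeFn_mul, h1, h2]
  smul_mem' := by
    rintro c d ⟨hd, hd'⟩
    refine ⟨?_, fun n hn => by simp [hd' n hn]⟩
    filter_upwards [hd] with n h1
    simp [h1]
  star_mem' := by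
    rintro d ⟨hd, hd'⟩
    refine ⟨?_, fun n hn => by simp [hd' n hn]⟩
    filter_upwards [hd] with n h1
    simp [map_star, h1]

/-- The `k`-th telescope algebra of an inductive system: the closure of the eventually coherent
sequences vanishing below `k`. -/
noncomputable def telescope (k : ℕ) : NonUnitalStarSubalgebra ℂ (lp D ∞) :=
  (coherentSubalgebra γ k).topologicalClosure

instance (k : ℕ) : IsClosed (telescope γ k : Set (lp D ∞)) :=
  (coherentSubalgebra γ k).isClosed_topologicalClosure

variable {γ}

lemma coherentSubalgebra_le_telescope (k : ℕ) : coherentSubalgebra γ k ≤ telescope γ k :=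
  NonUnitalStarSubalgebra.le_topologicalClosure _

lemma dense_coherent (k : ℕ) :
    Dense {x : telescope γ k | (x : lp D ∞) ∈ coherentSubalgebra γ k} := by
  rw [Metric.dense_iff]
  intro x r hr
  obtain ⟨y, hy, hxy⟩ := Metric.mem_closure_iff.1 x.2 r hr
  exact ⟨⟨y, coherentSubalgebra_le_telescope k hy⟩, by
    simpa [Metric.mem_ball, dist_comm, Subtype.dist_eq] using hxy, hy⟩

lemma telescope_apply_eq_zero {k : ℕ} (x : telescope γ k) {n : ℕ} (hn : n < k) :
    (x : lp D ∞) n = 0 := by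
  have hc : IsClosed {y : lp D ∞ | lpEval n y = 0} :=
    isClosed_eq (LipschitzWith.of_dist_le_mul (K := 1) fun a b => by
      simpa using (lpEval n).dist_map_le a b).continuous continuous_const
  exact closure_minimal (fun y hy => hy.2 n hn) hc x.2

lemma telescope_antitone (k : ℕ) : telescope γ (k + 1) ≤ telescope γ k :=
  NonUnitalStarSubalgebra.topologicalClosure_mono fun _ hd =>
    ⟨hd.1, fun n hn => hd.2 n (by omega)⟩

lemma lpTail_mem_telescope {k : ℕ} {d : lp D ∞} (hd : d ∈ telescope γ k) :
    lpTail (k + 1) d ∈ telescope γ (k + 1) := by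
  refine map_mem_closure (LipschitzWith.of_dist_le_mul (K := 1) fun a b => by
      simpa using (lpTail (k + 1)).dist_map_le a b).continuous hd fun e he => ⟨?_, ?_⟩
  · filter_upwards [he.1, eventually_ge_atTop (k + 1)] with n h1 h2
    have h3 : ¬ n < k + 1 := by omega
    have h4 : ¬ n < k := by omega
    simpa [h3, h4] using h1
  · intro n hn
    simp [hn]

variable (γ)

/-- The connecting morphism of the telescope algebras, erasing one entry. -/
noncomputable def telescopeMap (k : ℕ) : telescope γ k →⋆ₙₐ[ℂ] telescope γ (k + 1) :=
  NonUnitalStarAlgHom.codRestrict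
    ((lpTail (k + 1)).comp (NonUnitalStarSubalgebraClass.subtype (telescope γ k)))
    (telescope γ (k + 1)) fun x => lpTail_mem_telescope x.2

/-- Evaluation on a telescope algebra. -/
noncomputable def telescopeEval (k n : ℕ) : telescope γ k →⋆ₙₐ[ℂ] D n :=
  (lpEval n).comp (NonUnitalStarSubalgebraClass.subtype (telescope γ k))

variable {γ}

lemma telescopeMap_apply (k : ℕ) (x : telescope γ k) (n : ℕ) :
    (telescopeMap γ k x : lp D ∞) n = if n < k + 1 then 0 else (x : lp D ∞) n := rfl

lemma telescopeEval_apply (k n : ℕ) (x : telescope γ k) :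
    telescopeEval γ k n x = (x : lp D ∞) n := rfl

lemma telescopeMap_surjective (k : ℕ) : Function.Surjective (telescopeMap γ k) := by
  intro y
  refine ⟨⟨y, telescope_antitone k y.2⟩, ?_⟩
  ext n
  rw [telescopeMap_apply]
  split_ifs with h
  · exact (telescope_apply_eq_zero y h).symm
  · rfl

lemma iterHom_telescopeMap_apply (k n m : ℕ) (hm : k + n ≤ m) (x : telescope γ k) :
    (iterHom (telescopeMap γ) k n x : lp D ∞) m = (x : lp D ∞) m := by
  induction n with
  | zero => rfl
  | succ n ih =>
    change (telescopeMap γ (k + n) (iterHom (telescopeMap γ) k n x) : lp D ∞) m = _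
    rw [telescopeMap_apply, if_neg (by omega), ih (by omega)]

/-- The coherent sequence generated by an element of an inductive system. -/
noncomputable def coherentSeq (γ : ∀ k, D k →⋆ₙₐ[ℂ] D (k + 1)) (k : ℕ) (a : D k) : lp D ∞ :=
  ⟨fun m => transition γ k m a, memℓp_infty ⟨‖a‖, by
    rintro _ ⟨m, rfl⟩
    exact NonUnitalStarAlgHom.norm_apply_le _ _⟩⟩

lemma coherentSeq_mem (k : ℕ) (a : D k) : coherentSeq γ k a ∈ coherentSubalgebra γ k := by
  refine ⟨?_, fun n hn => transition_of_lt γ hn a⟩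
  filter_upwards [eventually_ge_atTop k] with n hn
  exact (transition_succ γ hn a).symm

lemma eq_transition_of_coherent {d : ∀ n, D n} {N : ℕ} (h : ∀ n ≥ N, γ n (d n) = d (n + 1))
    {n : ℕ} (hn : N ≤ n) : d n = transition γ N n (d N) := by
  induction n, hn using Nat.le_induction with
  | base => rw [transition_self]
  | succ n hn ih => rw [transition_succ γ hn, ← ih, h n hn]

variable {L : Type u} [NonUnitalCStarAlgebra L] {μ : ∀ k, D k →⋆ₙₐ[ℂ] L}

/-- The telescope algebras of an inductive system form an inductive system with surjective
connecting morphisms and the same limit. -/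
theorem IsInductiveLimit.exists_telescope (hL : IsInductiveLimit γ L μ) :
    ∃ π : ∀ k, telescope γ k →⋆ₙₐ[ℂ] L, IsInductiveLimit (telescopeMap γ) L π ∧
      ∀ k x, Tendsto (fun n => μ n (telescopeEval γ k n x)) atTop (𝓝 (π k x)) ∧
        Tendsto (fun n => ‖telescopeEval γ k n x‖) atTop (𝓝 ‖π k x‖) := by
  have hconst : ∀ k, ∀ x ∈ {x : telescope γ k | (x : lp D ∞) ∈ coherentSubalgebra γ k},
      ∃ N, (∀ n ≥ N, μ n (telescopeEval γ k n x) = μ N ((x : lp D ∞) N)) ∧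
        ∀ n ≥ N, telescopeEval γ k n x = transition γ N n ((x : lp D ∞) N) := by
    intro k x hx
    obtain ⟨N, hN⟩ := eventually_atTop.1 hx.1
    refine ⟨N, fun n hn => ?_, fun n hn => eq_transition_of_coherent hN hn⟩
    rw [telescopeEval_apply, eq_transition_of_coherent hN hn, map_transition hL.compat hn]
  have hlim : ∀ k, ∃ g : telescope γ k →⋆ₙₐ[ℂ] L, ∀ x,
      Tendsto (fun n => (μ n).comp (telescopeEval γ k n) x) atTop (𝓝 (g x)) := by
    intro k
    refine exists_pointwise_limit _ (dense_coherent k) fun x hx => ?_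
    obtain ⟨N, hN, -⟩ := hconst k x hx
    exact (tendsto_const_nhds.congr' <| by
      filter_upwards [eventually_ge_atTop N] with n hn using (hN n hn).symm).cauchySeq
  choose π hπ using hlim
  have hnorm : ∀ k x, Tendsto (fun n => ‖telescopeEval γ k n x‖) atTop (𝓝 ‖π k x‖) := by
    intro k
    refine tendsto_norm_of_dense _ _ (dense_coherent k) fun x hx => ?_
    obtain ⟨N, hN, hN'⟩ := hconst k x hx
    have h1 : π k x = μ N ((x : lp D ∞) N) := tendsto_nhds_unique (hπ k x) <|
      tendsto_const_nhds.congr' <| by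
        filter_upwards [eventually_ge_atTop N] with n hn using (hN n hn).symm
    rw [h1]
    refine ((tendsto_iterHom_iff N _ _).1 (hL.norm_tendsto N _)).congr' ?_
    filter_upwards [eventually_ge_atTop N] with n hn
    rw [hN' n hn]
  have hcompat : ∀ k, (π (k + 1)).comp (telescopeMap γ k) = π k := by
    intro k
    ext x
    refine tendsto_nhds_unique (hπ (k + 1) (telescopeMap γ k x)) ((hπ k x).congr' ?_)
    filter_upwards [eventually_ge_atTop (k + 1)] with n hn
    change μ n ((x : lp D ∞) n) = μ n ((telescopeMap γ k x : lp D ∞) n)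
    rw [telescopeMap_apply, if_neg (by omega)]
  refine ⟨π, ⟨hcompat, ?_, ?_⟩, fun k x => ⟨hπ k x, hnorm k x⟩⟩
  · refine hL.dense_union.mono (Set.iUnion_mono fun k => ?_)
    rintro _ ⟨a, rfl⟩
    refine ⟨⟨coherentSeq γ k a, coherentSubalgebra_le_telescope k (coherentSeq_mem k a)⟩, ?_⟩
    refine tendsto_nhds_unique (hπ k _) (tendsto_const_nhds.congr' ?_)
    filter_upwards [eventually_ge_atTop k] with n hn
    exact (map_transition hL.compat hn a).symm
  · intro k x
    rw [Metric.tendsto_atTop]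
    intro ε hε
    obtain ⟨N, hN⟩ := Metric.tendsto_atTop.1 (hnorm k x) (ε / 2) (by positivity)
    refine ⟨N, fun n hn => ?_⟩
    have hle : ‖π k x‖ ≤ ‖iterHom (telescopeMap γ) k n x‖ := by
      rw [iterHom_eq_transition, ← map_transition hcompat (Nat.le_add_right k n) x]
      exact NonUnitalStarAlgHom.norm_apply_le _ _
    have hge : ‖iterHom (telescopeMap γ) k n x‖ ≤ ‖π k x‖ + ε / 2 := by
      change ‖(iterHom (telescopeMap γ) k n x : lp D ∞)‖ ≤ _
      refine lp.norm_le_of_forall_le (by positivity) fun m => ?_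
      rcases lt_or_ge m (k + n) with hm | hm
      · rw [telescope_apply_eq_zero _ hm, norm_zero]
        positivity
      · rw [iterHom_telescopeMap_apply k n m hm]
        have h := hN m (by omega)
        rw [Real.dist_eq, telescopeEval_apply] at h
        linarith [(abs_lt.1 h).2]
    rw [Real.dist_eq, abs_lt]
    constructor <;> linarith

/-- Approximate lifting of morphisms from a weakly semiprojective algebra through an inductive
limit with arbitrary connecting morphisms. -/
theorem IsWeaklySemiprojective.eventually_exists_lift {B : Type u} [NonUnitalCStarAlgebra B]
    (hB : IsWeaklySemiprojective B) (hL : IsInductiveLimit γ L μ) (σ : B →⋆ₙₐ[ℂ] L)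
    {ε : ℝ} (hε : 0 < ε) (F : Finset B) :
    ∀ᶠ n in atTop, ∃ ψ : B →⋆ₙₐ[ℂ] D n, ∀ x ∈ F,
      ‖μ n (ψ x) - σ x‖ < ε ∧ ‖ψ x‖ < ‖σ x‖ + ε := by
  obtain ⟨π, hπ, hlim⟩ := hL.exists_telescope
  obtain ⟨k, φ, hφ⟩ := hB (fun k => telescope γ k) (telescopeMap γ) telescopeMap_surjective
    L π hπ σ ε hε F
  have h : ∀ x ∈ F, ∀ᶠ n in atTop, ‖μ n (telescopeEval γ k n (φ x)) - σ x‖ < ε ∧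
      ‖telescopeEval γ k n (φ x)‖ < ‖σ x‖ + ε := by
    intro x hx
    have hx' : ‖π k (φ x) - σ x‖ < ε := hφ x hx
    have hle : ‖π k (φ x)‖ < ‖σ x‖ + ε := by
      linarith [norm_le_norm_add_norm_sub' (π k (φ x)) (σ x)]
    exact ((((hlim k (φ x)).1.sub_const (σ x)).norm).eventually_lt_const hx').and
      ((hlim k (φ x)).2.eventually_lt_const hle)
  filter_upwards [(Filter.eventually_all_finset F).2 h] with n hn
  exact ⟨(telescopeEval γ k n).comp φ, hn⟩

end Telescope

section Intertwining

/-- One-sided approximate intertwining: morphisms into `A` which are approximately compatible and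
approximately isometric on exhausting sets exhibit `A` as an inductive limit. -/
theorem exists_isInductiveLimit_of_approx {B : ℕ → Type u} [∀ j, NonUnitalCStarAlgebra (B j)]
    {A : Type v} [NonUnitalCStarAlgebra A] (ψ : ∀ j, B j →⋆ₙₐ[ℂ] B (j + 1))
    (θ : ∀ j, B j →⋆ₙₐ[ℂ] A) (F : ∀ j, Set (B j))
    (hF : ∀ j, ∀ x ∈ F j, ψ j x ∈ F (j + 1))
    (hdense : ∀ j, Dense {x : B j | ∀ᶠ m in atTop, transition ψ j m x ∈ F m})
    (hθ : ∀ j, ∀ x ∈ F j, ‖θ (j + 1) (ψ j x) - θ j x‖ ≤ (1 / 2) ^ j)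
    (hψ : ∀ j, ∀ x ∈ F j, ‖ψ j x‖ ≤ ‖θ j x‖ + (1 / 2) ^ j)
    (hA : ∀ a : A, ∀ ε > 0, ∃ᶠ j in atTop, ∃ x ∈ F j, ‖θ j x - a‖ < ε) :
    ∃ μ : ∀ j, B j →⋆ₙₐ[ℂ] A, IsInductiveLimit ψ A μ := by
  have hstep : ∀ j (x : B j) M, j ≤ M → (∀ m ≥ M, transition ψ j m x ∈ F m) → ∀ n,
      dist (θ (n + M) (transition ψ j (n + M) x))
        (θ (n + 1 + M) (transition ψ j (n + 1 + M) x)) ≤ (1 / 2) ^ M * (1 / 2) ^ n := by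
    intro j x M hjM hM n
    have h := hθ (n + M) _ (hM (n + M) (by omega))
    rw [← transition_succ ψ (by omega), ← dist_eq_norm, dist_comm, pow_add, mul_comm,
      show n + M + 1 = n + 1 + M by omega] at h
    exact h
  have hlim : ∀ j, ∃ g : B j →⋆ₙₐ[ℂ] A, ∀ x,
      Tendsto (fun m => (θ m).comp (transition ψ j m) x) atTop (𝓝 (g x)) := by
    intro j
    refine exists_pointwise_limit _ (hdense j) fun x hx => ?_
    obtain ⟨M, hM⟩ := eventually_atTop.1 ((eventually_ge_atTop j).and hx)
    rw [← cauchySeq_shift M]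
    exact cauchySeq_of_le_geometric _ _ (by norm_num)
      (hstep j x M (hM M le_rfl).1 fun m hm => (hM m hm).2)
  choose μ hμ using hlim
  have hcompat : ∀ k, (μ (k + 1)).comp (ψ k) = μ k := by
    intro k
    ext x
    refine tendsto_nhds_unique (hμ (k + 1) (ψ k x)) ((hμ k x).congr' ?_)
    filter_upwards [eventually_ge_atTop (k + 1)] with m hm
    exact congrArg (θ m) (transition_succ_left ψ hm x).symm
  refine ⟨μ, hcompat, fun a => ?_, fun j x => (tendsto_iterHom_iff j x _).2 ?_⟩
  · rw [Metric.mem_closure_iff]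
    intro ε hε
    have hsmall : ∀ᶠ j : ℕ in atTop, (1 / 2 : ℝ) ^ j / (1 - 1 / 2) < ε / 2 := by
      have h := (tendsto_pow_atTop_nhds_zero_of_lt_one (r := (1 / 2 : ℝ)) (by norm_num)
        (by norm_num)).div_const (1 - 1 / 2)
      rw [zero_div] at h
      exact h.eventually_lt_const (by positivity)
    obtain ⟨j, ⟨x, hx, hxa⟩, hj⟩ := ((hA a (ε / 2) (by positivity)).and_eventually hsmall).exists
    refine ⟨μ j x, Set.mem_iUnion.2 ⟨j, x, rfl⟩, ?_⟩
    have hmem : ∀ m ≥ j, transition ψ j m x ∈ F m := by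
      intro m hm
      induction m, hm using Nat.le_induction with
      | base => rwa [transition_self]
      | succ m hm ih =>
        rw [transition_succ ψ hm]
        exact hF m _ ih
    have h := dist_le_of_le_geometric_of_tendsto₀ (1 / 2) _ (by norm_num)
      (hstep j x j le_rfl hmem) ((tendsto_add_atTop_iff_nat j).2 (hμ j x))
    have h0 : θ (0 + j) (transition ψ j (0 + j) x) = θ j x := by
      rw [Nat.zero_add, transition_self]
    rw [h0] at h
    rw [← dist_eq_norm, dist_comm] at hxa
    linarith [dist_triangle a (θ j x) (μ j x)]
  · refine tendsto_norm_of_dense _ _ (hdense j) (fun x hx => ?_) x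
    rw [← tendsto_add_atTop_iff_nat 1]
    have h1 := (hμ j x).norm
    have h2 := h1.add (tendsto_pow_atTop_nhds_zero_of_lt_one (r := (1 / 2 : ℝ)) (by norm_num)
      (by norm_num))
    rw [add_zero] at h2
    refine tendsto_of_tendsto_of_tendsto_of_le_of_le' ((tendsto_add_atTop_iff_nat 1).2 h1) h2
      (Eventually.of_forall fun m => NonUnitalStarAlgHom.norm_apply_le (θ (m + 1)) _) ?_
    filter_upwards [hx, eventually_ge_atTop j] with m hm hjm
    rw [transition_succ ψ hjm]
    exact hψ m _ hm

end Intertwining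

section DoubleLimit

variable {A : Type u} [NonUnitalCStarAlgebra A] {Ak : ℕ → Type u}
  [∀ k, NonUnitalCStarAlgebra (Ak k)] {γ : ∀ k, Ak k →⋆ₙₐ[ℂ] Ak (k + 1)}
  {μ : ∀ k, Ak k →⋆ₙₐ[ℂ] A} {A' : ℕ → ℕ → Type u} [∀ k n, NonUnitalCStarAlgebra (A' k n)]
  {ρ : ∀ k n, A' k n →⋆ₙₐ[ℂ] A' k (n + 1)} {ν : ∀ k n, A' k n →⋆ₙₐ[ℂ] Ak k}

/-- In a limit of limits, a weakly semiprojective building block maps to another building block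
approximately compatibly with the maps to the limit, approximately isometrically on its image,
and such that the new block approximately exhausts a given finite set. -/
lemma exists_approx_map_of_double_limit (hA : IsInductiveLimit γ A μ)
    (hAk : ∀ k, IsInductiveLimit (ρ k) (Ak k) (ν k)) {k n : ℕ}
    (hB : IsWeaklySemiprojective (A' k n)) {ε : ℝ} (hε : 0 < ε) (F : Finset (A' k n))
    (G : Finset A) :
    ∃ (p : ℕ × ℕ) (ψ : A' k n →⋆ₙₐ[ℂ] A' p.1 p.2),
      (∀ x ∈ F, ‖μ p.1 (ν p.1 p.2 (ψ x)) - μ k (ν k n x)‖ ≤ ε ∧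
        ‖ψ x‖ ≤ ‖μ k (ν k n x)‖ + ε) ∧
      ∀ g ∈ G, ∃ b, ‖μ p.1 (ν p.1 p.2 b) - g‖ ≤ ε := by
  have hε2 : 0 < ε / 2 := by positivity
  have h1 : ∀ x ∈ F, ∀ᶠ K in atTop, ‖transition γ k K (ν k n x)‖ < ‖μ k (ν k n x)‖ + ε / 2 :=
    fun x _ => ((tendsto_iterHom_iff k _ _).1 (hA.norm_tendsto k (ν k n x))).eventually_lt_const
      (by linarith)
  have h2 : ∀ g ∈ G, ∀ᶠ K in atTop, ∃ c : Ak K, ‖μ K c - g‖ < ε / 2 :=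
    fun g _ => hA.eventually_exists_norm_sub_lt hε2 g
  obtain ⟨K, hkK, hK1, hK2⟩ := ((eventually_ge_atTop k).and
    (((Filter.eventually_all_finset F).2 h1).and ((Filter.eventually_all_finset G).2 h2))).exists
  choose! c hc using hK2
  obtain ⟨N, ⟨ψ, hψ⟩, hN⟩ := ((hB.eventually_exists_lift (hAk K)
    ((transition γ k K).comp (ν k n)) hε2 F).and ((Filter.eventually_all_finset G).2
      fun g _ => (hAk K).eventually_exists_norm_sub_lt hε2 (c g))).exists
  refine ⟨(K, N), ψ, fun x hx => ⟨?_, ?_⟩, fun g hg => ?_⟩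
  · have h := (μ K).dist_map_le (ν K N (ψ x)) (transition γ k K (ν k n x))
    rw [map_transition hA.compat hkK, dist_eq_norm, dist_eq_norm] at h
    have h' : ‖ν K N (ψ x) - transition γ k K (ν k n x)‖ < ε / 2 := (hψ x hx).1
    linarith
  · have h : ‖ψ x‖ < ‖transition γ k K (ν k n x)‖ + ε / 2 := (hψ x hx).2
    linarith [hK1 x hx]
  · obtain ⟨b, hb⟩ := hN g hg
    refine ⟨b, ?_⟩
    have h := (μ K).dist_map_le (ν K N b) (c g)
    have h' := dist_triangle (μ K (ν K N b)) (μ K (c g)) g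
    rw [dist_eq_norm, dist_eq_norm] at h
    rw [dist_eq_norm, dist_eq_norm, dist_eq_norm] at h'
    linarith [hc g hg]

end DoubleLimit

open TopologicalSpace in
/-- Criterion "AA𝒞 implies A𝒞": an inductive limit of inductive limits of (separable) weakly
semiprojective C*-algebras is itself an inductive limit of some of those algebras. -/
theorem AAC_implies_AC
    (A : Type u) [NonUnitalCStarAlgebra A] [SeparableSpace A]
    (Ak : ℕ → Type u) [∀ k, NonUnitalCStarAlgebra (Ak k)] [∀ k, SeparableSpace (Ak k)]
    (γ : ∀ k, Ak k →⋆ₙₐ[ℂ] Ak (k + 1)) (μ : ∀ k, Ak k →⋆ₙₐ[ℂ] A)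
    (hA : IsInductiveLimit γ A μ)
    (A' : ℕ → ℕ → Type u) [∀ k n, NonUnitalCStarAlgebra (A' k n)]
    [∀ k n, SeparableSpace (A' k n)]
    (ρ : ∀ k n, A' k n →⋆ₙₐ[ℂ] A' k (n + 1)) (ν : ∀ k n, A' k n →⋆ₙₐ[ℂ] Ak k)
    (hAk : ∀ k, IsInductiveLimit (ρ k) (Ak k) (ν k))
    (hwsp : ∀ k n, IsWeaklySemiprojective (A' k n)) :
    ∃ (kn : ℕ → ℕ × ℕ)
      (ψ : ∀ j, A' (kn j).1 (kn j).2 →⋆ₙₐ[ℂ] A' (kn (j + 1)).1 (kn (j + 1)).2)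
      (μ' : ∀ j, A' (kn j).1 (kn j).2 →⋆ₙₐ[ℂ] A),
      IsInductiveLimit ψ A μ' := by

  let θ : ∀ p : ℕ × ℕ, A' p.1 p.2 →⋆ₙₐ[ℂ] A := fun p => (μ p.1).comp (ν p.1 p.2)
  let g : ℕ → A := denseSeq A
  let State := Σ p : ℕ × ℕ, ℕ → ℕ → A' p.1 p.2
  have hstep : ∀ (j : ℕ) (s : State), ∃ (t : State) (ψ : A' s.1.1 s.1.2 →⋆ₙₐ[ℂ] A' t.1.1 t.1.2),
      (∀ i r, t.2 (i + 2) r = ψ (s.2 i r)) ∧ DenseRange (t.2 0) ∧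
      (∀ r ≤ j, ‖θ t.1 (t.2 1 r) - g r‖ ≤ (1 / 2) ^ j) ∧
      ∀ i ≤ 2 * j + 1, ∀ r ≤ j, ‖θ t.1 (ψ (s.2 i r)) - θ s.1 (s.2 i r)‖ ≤ (1 / 2) ^ j ∧
        ‖ψ (s.2 i r)‖ ≤ ‖θ s.1 (s.2 i r)‖ + (1 / 2) ^ j := by
    classical
    rintro j ⟨p, S⟩
    obtain ⟨q, ψ, hψ, hG⟩ := exists_approx_map_of_double_limit hA hAk (hwsp p.1 p.2)
      (ε := (1 / 2) ^ j) (by positivity)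
      ((Finset.range (2 * j + 2) ×ˢ Finset.range (j + 1)).image fun z => S z.1 z.2)
      ((Finset.range (j + 1)).image g)
    choose! b hb using hG
    refine ⟨⟨q, fun i r => match i with
      | 0 => denseSeq (A' q.1 q.2) r
      | 1 => b (g r)
      | i + 2 => ψ (S i r)⟩, ψ, fun i r => rfl, denseRange_denseSeq _, fun r hr => ?_,
      fun i hi r hr => ?_⟩
    · exact hb (g r) (Finset.mem_image_of_mem g (Finset.mem_range.2 (by omega)))
    · exact hψ (S i r) (Finset.mem_image.2 ⟨(i, r), by
        rw [Finset.mem_product, Finset.mem_range, Finset.mem_range]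
        constructor <;> dsimp only <;> omega, rfl⟩)
  choose next Ψ hsucc hdense happrox hbound using hstep
  let st : ℕ → State := fun j => Nat.rec ⟨(0, 0), fun _ r => denseSeq (A' 0 0) r⟩ next j
  let ψ : ∀ j, A' (st j).1.1 (st j).1.2 →⋆ₙₐ[ℂ] A' (st (j + 1)).1.1 (st (j + 1)).1.2 :=
    fun j => Ψ j (st j)
  have htrans : ∀ j m, j ≤ m → ∀ i r, transition (D := fun j => A' (st j).1.1 (st j).1.2) ψ j m
      ((st j).2 i r) = (st m).2 (i + 2 * (m - j)) r := by
    intro j m hm i r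
    induction m, hm using Nat.le_induction with
    | base => rw [transition_self, Nat.sub_self, Nat.mul_zero, Nat.add_zero]
    | succ m hm ih =>
      rw [transition_succ _ hm, ih,
        show i + 2 * (m + 1 - j) = i + 2 * (m - j) + 2 by omega]
      exact (hsucc m (st m) _ r).symm
  refine ⟨fun j => (st j).1, ψ, exists_isInductiveLimit_of_approx
    (B := fun j => A' (st j).1.1 (st j).1.2) ψ (fun j => θ (st j).1)
    (fun j => {x | ∃ i ≤ 2 * j + 1, ∃ r ≤ j, (st j).2 i r = x}) ?_ ?_ ?_ ?_ ?_⟩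
  · rintro j _ ⟨i, hi, r, hr, rfl⟩
    exact ⟨i + 2, by omega, r, by omega, hsucc j (st j) i r⟩
  · intro j
    have hd : DenseRange ((st j).2 0) := by
      cases j with
      | zero => exact denseRange_denseSeq (A' 0 0)
      | succ j => exact hdense j (st j)
    refine hd.mono ?_
    rintro _ ⟨r, rfl⟩
    filter_upwards [eventually_ge_atTop j, eventually_ge_atTop r] with m hjm hrm
    exact ⟨0 + 2 * (m - j), by omega, r, hrm, (htrans j m hjm 0 r).symm⟩
  · rintro j _ ⟨i, hi, r, hr, rfl⟩
    exact (hbound j (st j) i hi r hr).1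
  · rintro j _ ⟨i, hi, r, hr, rfl⟩
    exact (hbound j (st j) i hi r hr).2
  · intro a ε hε
    obtain ⟨r, hr⟩ := (denseRange_denseSeq A).exists_dist_lt a (half_pos hε)
    refine Filter.Eventually.frequently ?_
    have hsmall := (tendsto_pow_atTop_nhds_zero_of_lt_one (r := (1 / 2 : ℝ)) (by norm_num)
      (by norm_num)).eventually_lt_const (half_pos hε)
    obtain ⟨N, hN⟩ := eventually_atTop.1 hsmall
    filter_upwards [eventually_ge_atTop (max N r + 1)] with m hm
    obtain ⟨j, rfl⟩ : ∃ j, m = j + 1 := ⟨m - 1, by omega⟩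
    refine ⟨(st (j + 1)).2 1 r, ⟨1, by omega, r, by omega, rfl⟩, ?_⟩
    have h1 : ‖θ (st (j + 1)).1 ((st (j + 1)).2 1 r) - g r‖ ≤ (1 / 2) ^ j :=
      happrox j (st j) r (by omega)
    have h2 := hN j (by omega)
    rw [dist_comm] at hr
    rw [← dist_eq_norm] at h1 ⊢
    have h3 := dist_triangle (θ (st (j + 1)).1 ((st (j + 1)).2 1 r)) (g r) a
    have h4 : dist (g r) a < ε / 2 := hr
    linarith
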